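/- In the warden's game with n dice each having m sides (m ≥ 1, n ≥ 1), for every natural number k ≥ 1, if no position has remoteness equal to k, then no position has remoteness equal to k+1. -/

import Mathlib

/-- One move: the rightmost entry is transferred to the far left, becoming `c`,
producing `(c, x₀, …, x_{n−2})`. -/
def shift {α : Type*} {n : ℕ} (c : α) (x : Fin n → α) : Fin n → α :=
  fun i => if _h : (i : ℕ) = 0 then c
    else x ⟨(i : ℕ) - 1, lt_of_le_of_lt (Nat.sub_le _ _) i.isLt⟩

/-- The goal position: every die shows `m - 1`. -/
def goalPos (m n : ℕ) (hm : 1 ≤ m) : Fin n → Fin m :=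
  fun _ => ⟨m - 1, Nat.sub_lt hm Nat.one_pos⟩

/-- `CanWin m n hm hn N x`: the prisoner can force the goal within `N` moves from
position `x`.  It holds iff `x` is the goal, or `N ≥ 1` and both:
(i) for every warden choice `c < x_{n-1}`, `CanWin (N-1)` holds at `(c, x₀, …, x_{n−2})`, and
(ii) there is a prisoner choice `c ≥ x_{n-1}` with `CanWin (N-1)` at `(c, x₀, …, x_{n−2})`. -/
def CanWin (m n : ℕ) (hm : 1 ≤ m) (hn : 1 ≤ n) : ℕ → (Fin n → Fin m) → Prop
  | 0, x => x = goalPos m n hm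
  | N + 1, x => x = goalPos m n hm ∨
      ((∀ c : Fin m, c < x ⟨n - 1, Nat.sub_lt hn Nat.one_pos⟩ →
          CanWin m n hm hn N (shift c x)) ∧
       ∃ c : Fin m, x ⟨n - 1, Nat.sub_lt hn Nat.one_pos⟩ ≤ c ∧
          CanWin m n hm hn N (shift c x))

/-- The remoteness of a position: the least `N` with `CanWin N x`. -/
noncomputable def remoteness (m n : ℕ) (hm : 1 ≤ m) (hn : 1 ≤ n)
    (x : Fin n → Fin m) : ℕ :=
  sInf {N | CanWin m n hm hn N x}

theorem CanWin.succ {m n : ℕ} {hm : 1 ≤ m} {hn : 1 ≤ n} {N : ℕ} {x : Fin n → Fin m}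
    (h : CanWin m n hm hn N x) : CanWin m n hm hn (N + 1) x := by
  induction N generalizing x with
  | zero => exact Or.inl h
  | succ N ih =>
    rcases h with h | ⟨h₁, c, hc, h₂⟩
    · exact Or.inl h
    · exact Or.inr ⟨fun d hd => ih (h₁ d hd), c, hc, ih h₂⟩

theorem CanWin.mono {m n : ℕ} {hm : 1 ≤ m} {hn : 1 ≤ n} {M N : ℕ} (hMN : M ≤ N)
    {x : Fin n → Fin m} (h : CanWin m n hm hn M x) : CanWin m n hm hn N x :=
  Nat.le_induction h (fun _ _ => CanWin.succ) N hMN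

theorem remoteness_eq_succ_iff {m n : ℕ} {hm : 1 ≤ m} {hn : 1 ≤ n} {N : ℕ}
    {x : Fin n → Fin m} :
    remoteness m n hm hn x = N + 1 ↔
      CanWin m n hm hn (N + 1) x ∧ ¬ CanWin m n hm hn N x :=
  Nat.sInf_upward_closed_eq_succ_iff (fun _ _ hMN h => CanWin.mono hMN h) N

/-- If `k ≥ 1` and no position has remoteness `k`, then no position has
remoteness `k + 1`. -/
theorem no_remoteness_succ (m n : ℕ) (hm : 1 ≤ m) (hn : 1 ≤ n) (k : ℕ) (hk : 1 ≤ k)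
    (h : ∀ x : Fin n → Fin m, remoteness m n hm hn x ≠ k) :
    ∀ x : Fin n → Fin m, remoteness m n hm hn x ≠ k + 1 := by
  intro x hx
  obtain ⟨j, rfl⟩ := Nat.exists_eq_add_of_le' hk
  have step (y : Fin n → Fin m) (hy : CanWin m n hm hn (j + 1) y) : CanWin m n hm hn j y := by
    by_contra hj
    exact h y (remoteness_eq_succ_iff.2 ⟨hy, hj⟩)
  obtain ⟨hwin, hlose⟩ := remoteness_eq_succ_iff.1 hx
  refine hlose ?_
  rcases hwin with hg | ⟨h₁, c, hc, h₂⟩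
  · exact Or.inl hg
  · exact Or.inr ⟨fun d hd => step _ (h₁ d hd), c, hc, step _ h₂⟩
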